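/- Let n ∈ ℕ with n ≥ 1 and 0 < α < β ≤ 1. For every φ₀ ∈ D^{n,β}(ℝ^d) − Id there exist δ > 0 (with the ball of radius δ around φ₀ in ‖·‖_{n,β} contained in D^{n,β}(ℝ^d) − Id) and a constant M = M(n, φ₀, δ) such that for all φ₁, φ₂ with ‖φᵢ − φ₀‖_{n,β} < δ: ‖inv_c(φ₁) − inv_c(φ₂)‖_{n,α} ≤ M ‖φ₁ − φ₂‖_{n,α}^{β−α}, where inv_c(φ) := (Id+φ)⁻¹ − Id. In particular, Φ ↦ Φ⁻¹ is continuous from D^{n,β}(ℝ^d) to D^{n,α}(ℝ^d). -/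

import Mathlib

open Function Set Filter Topology MeasureTheory
open scoped ENNReal NNReal

noncomputable section

section Defs

variable {E F : Type*} [NormedAddCommGroup E] [NormedSpace ℝ E]
  [NormedAddCommGroup F] [NormedSpace ℝ F]

/-- `‖f‖_n = max_{0 ≤ l ≤ n} sup_x ‖f⁽ˡ⁾(x)‖`, as an extended real. -/
def eCnb (n : ℕ) (f : E → F) : ℝ≥0∞ :=
  ⨆ (l : Fin (n + 1)) (x : E), (‖iteratedFDeriv ℝ (l : ℕ) f x‖₊ : ℝ≥0∞)

/-- The Hölder seminorm `[f]_{n,α}`, as an extended real. -/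
def eHsemi (n : ℕ) (α : ℝ) (f : E → F) : ℝ≥0∞ :=
  ⨆ (x : E) (y : E) (_ : x ≠ y),
    (‖iteratedFDeriv ℝ n f x - iteratedFDeriv ℝ n f y‖₊ : ℝ≥0∞) / edist x y ^ α

/-- The Hölder norm `‖f‖_{n,α} = max(‖f‖_n, [f]_{n,α})`, as an extended real. -/
def eHnorm (n : ℕ) (α : ℝ) (f : E → F) : ℝ≥0∞ := max (eCnb n f) (eHsemi n α f)

/-- The Hölder norm `‖f‖_{n,α}` as a real number (junk value `0` when infinite). -/
def hnorm (n : ℕ) (α : ℝ) (f : E → F) : ℝ := (eHnorm n α f).toReal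

/-- Membership in the global Hölder space `C^{n,α}_b(E,F)`. -/
def MemCb (n : ℕ) (α : ℝ) (f : E → F) : Prop :=
  ContDiff ℝ (n : ℕ∞) f ∧ eHnorm n α f < ⊤

/-- Membership in `C^{n,α}_0(E,F)`: moreover all derivatives up to order `n`
vanish at infinity. -/
def MemC0 (n : ℕ) (α : ℝ) (f : E → F) : Prop :=
  MemCb n α f ∧
    ∀ l ≤ n, Tendsto (fun x => ‖iteratedFDeriv ℝ l f x‖) (cocompact E) (𝓝 0)

end Defs

/-- `ℝ^d` -/
abbrev Euc (d : ℕ) : Type := EuclideanSpace ℝ (Fin d)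

/-- Membership in the diffeomorphism group `D^{n,β}(ℝ^d)`:
`Φ - Id ∈ C^{n,β}_0` and `det dΦ(x) > 0` everywhere. -/
def MemD (d n : ℕ) (β : ℝ) (Φ : Euc d → Euc d) : Prop :=
  MemC0 n β (fun x => Φ x - x) ∧
    ∀ x, 0 < LinearMap.det ((fderiv ℝ Φ x : Euc d →L[ℝ] Euc d) : Euc d →ₗ[ℝ] Euc d)

end

/-- The chart representation of inversion: `inv_c(φ) = (Id+φ)⁻¹ − Id`. -/
noncomputable def invc {d : ℕ} (φ : Euc d → Euc d) : Euc d → Euc d :=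
  fun x => Function.invFun (fun y => y + φ y) x - x

section UniformHolder

set_option linter.unusedSectionVars false

universe u v

variable {ι : Type v} {E F G H : Type u}
  [NormedAddCommGroup E] [NormedSpace ℝ E] [NormedAddCommGroup F] [NormedSpace ℝ F]
  [NormedAddCommGroup G] [NormedSpace ℝ G] [NormedAddCommGroup H] [NormedSpace ℝ H]
  {ε : ι → ι → ℝ} {β : ℝ}

/-- The family `f` is uniformly bounded and jointly `β`-Hölder on `ι × E`, where `ε` plays the
role of a distance on the index set. -/
def UnifHolder (ε : ι → ι → ℝ) (β : ℝ) (f : ι → E → F) : Prop :=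
  ∃ C, 0 ≤ C ∧ (∀ i x, ‖f i x‖ ≤ C) ∧
    ∀ i j x y, ‖f i x - f j y‖ ≤ C * (ε i j + ‖x - y‖) ^ β

/-- All derivatives up to order `n` of the family `f` are jointly `β`-Hölder on `ι × E`. -/
def UnifHolderN (ε : ι → ι → ℝ) (β : ℝ) : ℕ → {F : Type u} → [NormedAddCommGroup F] →
    [NormedSpace ℝ F] → (ι → E → F) → Prop
  | 0, _, _, _, f => UnifHolder ε β f
  | n + 1, _, _, _, f => UnifHolder ε β f ∧ (∀ i, Differentiable ℝ (f i)) ∧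
      UnifHolderN ε β n (fun i => fderiv ℝ (f i))

theorem UnifHolderN.of_succ {n : ℕ} {f : ι → E → F} (h : UnifHolderN ε β (n + 1) f) :
    UnifHolderN ε β n f := by
  induction n generalizing F with
  | zero => exact h.1
  | succ n ih => exact ⟨h.1, h.2.1, ih h.2.2⟩

theorem UnifHolderN.mono {m n : ℕ} {f : ι → E → F} (h : UnifHolderN ε β n f) (hmn : m ≤ n) :
    UnifHolderN ε β m f := by
  induction hmn with
  | refl => exact h
  | step _ ih => exact ih h.of_succ

theorem UnifHolder.add {f g : ι → E → F}
    (hf : UnifHolder ε β f) (hg : UnifHolder ε β g) :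
    UnifHolder ε β (fun i x => f i x + g i x) := by
  obtain ⟨C, hC, hb, hh⟩ := hf
  obtain ⟨D, hD, hb', hh'⟩ := hg
  refine ⟨C + D, by positivity, fun i x => (norm_add_le _ _).trans (add_le_add (hb i x) (hb' i x)),
    fun i j x y => ?_⟩
  rw [add_sub_add_comm, add_mul]
  exact (norm_add_le _ _).trans (add_le_add (hh i j x y) (hh' i j x y))

theorem UnifHolderN.add {n : ℕ} {f g : ι → E → F}
    (hf : UnifHolderN ε β n f) (hg : UnifHolderN ε β n g) :
    UnifHolderN ε β n (fun i x => f i x + g i x) := by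
  induction n generalizing F with
  | zero => exact UnifHolder.add hf hg
  | succ n ih =>
    refine ⟨hf.1.add hg.1, fun i => (hf.2.1 i).add (hg.2.1 i), ?_⟩
    convert ih hf.2.2 hg.2.2 using 3 with i x
    exact fderiv_fun_add (hf.2.1 i x) (hg.2.1 i x)

theorem UnifHolderN.const (hε : ∀ i j, 0 ≤ ε i j) (n : ℕ) (c : F) :
    UnifHolderN ε β n (fun (_ : ι) (_ : E) => c) := by
  have h0 : ∀ {F : Type u} [NormedAddCommGroup F] [NormedSpace ℝ F] (c : F),
      UnifHolder ε β (fun (_ : ι) (_ : E) => c) := fun c =>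
    ⟨‖c‖, norm_nonneg _, fun _ _ => le_rfl, fun i j x y => by
      have := hε i j
      rw [sub_self, norm_zero]
      positivity⟩
  induction n generalizing F with
  | zero => exact h0 c
  | succ n ih =>
    refine ⟨h0 c, fun i => differentiable_const c, ?_⟩
    simp only [fderiv_fun_const]
    exact ih (0 : E →L[ℝ] F)

theorem UnifHolder.neg {f : ι → E → F} (hf : UnifHolder ε β f) :
    UnifHolder ε β (fun i x => -f i x) := by
  obtain ⟨C, hC, hb, hh⟩ := hf
  refine ⟨C, hC, fun i x => by simpa using hb i x, fun i j x y => ?_⟩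
  rw [neg_sub_neg, norm_sub_rev]
  exact hh i j x y

theorem UnifHolderN.neg {n : ℕ} {f : ι → E → F} (hf : UnifHolderN ε β n f) :
    UnifHolderN ε β n (fun i x => -f i x) := by
  induction n generalizing F with
  | zero => exact UnifHolder.neg hf
  | succ n ih =>
    refine ⟨hf.1.neg, fun i => (hf.2.1 i).neg, ?_⟩
    convert ih hf.2.2 using 3 with i x
    exact fderiv_fun_neg

theorem UnifHolder.bilin (hε : ∀ i j, 0 ≤ ε i j) (B : F →L[ℝ] G →L[ℝ] H) {f : ι → E → F}
    {g : ι → E → G} (hf : UnifHolder ε β f) (hg : UnifHolder ε β g) :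
    UnifHolder ε β (fun i x => B (f i x) (g i x)) := by
  obtain ⟨C, hC, hb, hh⟩ := hf
  obtain ⟨D, hD, hb', hh'⟩ := hg
  refine ⟨2 * (‖B‖ * C * D), by positivity, fun i x => ?_, fun i j x y => ?_⟩
  · have h1 : ‖B (f i x) (g i x)‖ ≤ ‖B‖ * C * D :=
      (B.le_opNorm₂ _ _).trans (by gcongr; exacts [hb i x, hb' i x])
    have : 0 ≤ ‖B‖ * C * D := by positivity
    linarith
  · have h0 : 0 ≤ (ε i j + ‖x - y‖) ^ β := by
      have := hε i j
      positivity
    have : B (f i x) (g i x) - B (f j y) (g j y)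
        = B (f i x - f j y) (g i x) + B (f j y) (g i x - g j y) := by
      simp
    rw [this]
    have h1 : ‖B (f i x - f j y) (g i x)‖ ≤ ‖B‖ * (C * (ε i j + ‖x - y‖) ^ β) * D :=
      (B.le_opNorm₂ _ _).trans (by gcongr; exacts [hh i j x y, hb' i x])
    have h2 : ‖B (f j y) (g i x - g j y)‖ ≤ ‖B‖ * C * (D * (ε i j + ‖x - y‖) ^ β) :=
      (B.le_opNorm₂ _ _).trans (by gcongr; exacts [hb j y, hh' i j x y])
    refine (norm_add_le _ _).trans ((add_le_add h1 h2).trans (le_of_eq ?_))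
    ring

theorem UnifHolderN.bilin (hε : ∀ i j, 0 ≤ ε i j) {n : ℕ} (B : F →L[ℝ] G →L[ℝ] H) {f : ι → E → F}
    {g : ι → E → G} (hf : UnifHolderN ε β n f) (hg : UnifHolderN ε β n g) :
    UnifHolderN ε β n (fun i x => B (f i x) (g i x)) := by
  induction n generalizing F G H with
  | zero => exact UnifHolder.bilin hε B hf hg
  | succ n ih =>
    refine ⟨hf.1.bilin hε B hg.1,
      fun i => B.isBoundedBilinearMap.differentiable.comp ((hf.2.1 i).prodMk (hg.2.1 i)), ?_⟩
    convert (ih (B.precompR E) hf.of_succ hg.2.2).add (ih (B.precompL E) hf.2.2 hg.of_succ)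
      using 3 with i x
    exact B.fderiv_of_bilinear (hf.2.1 i x) (hg.2.1 i x)

theorem UnifHolder.comp (hε : ∀ i j, 0 ≤ ε i j) (hβ : 0 ≤ β) {f : ι → E → F} {g : ι → E → E}
    (hf : UnifHolder ε β f) {K : ℝ} (hK : 0 ≤ K)
    (hg : ∀ i j x y, ‖g i x - g j y‖ ≤ K * (ε i j + ‖x - y‖)) :
    UnifHolder ε β (fun i x => f i (g i x)) := by
  obtain ⟨C, hC, hb, hh⟩ := hf
  have h1 : 1 ≤ (1 + K) ^ β := Real.one_le_rpow (by linarith) hβ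
  refine ⟨C * (1 + K) ^ β, by positivity, fun i x => (hb i _).trans (le_mul_of_one_le_right hC h1),
    fun i j x y => ?_⟩
  have h0 := hε i j
  rw [mul_assoc, ← Real.mul_rpow (by positivity) (by positivity)]
  refine (hh i j _ _).trans ?_
  gcongr
  have := hg i j x y
  have := norm_nonneg (x - y)
  linarith

theorem UnifHolderN.comp (hε : ∀ i j, 0 ≤ ε i j) (hβ : 0 ≤ β) {n : ℕ} {f : ι → E → F}
    {g : ι → E → E} (hf : UnifHolderN ε β n f) {K : ℝ} (hK : 0 ≤ K)
    (hg : ∀ i j x y, ‖g i x - g j y‖ ≤ K * (ε i j + ‖x - y‖))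
    (hgd : ∀ i, Differentiable ℝ (g i))
    (hg' : ∀ m < n, UnifHolderN ε β m (fun i => fderiv ℝ (g i))) :
    UnifHolderN ε β n (fun i x => f i (g i x)) := by
  induction n generalizing F with
  | zero => exact UnifHolder.comp hε hβ hf hK hg
  | succ n ih =>
    refine ⟨hf.1.comp hε hβ hK hg, fun i => (hf.2.1 i).comp (hgd i), ?_⟩
    convert (ih hf.2.2 fun m hm => hg' m (by omega)).bilin hε (ContinuousLinearMap.compL ℝ E E F)
      (hg' n (by omega)) using 3 with i x
    exact fderiv_fun_comp x (hf.2.1 i _) (hgd i x)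

theorem UnifHolder.inverse {R : Type u} [NormedRing R] [NormedAlgebra ℝ R]
    (hε : ∀ i j, 0 ≤ ε i j) {A B : ι → E → R}
    (hA : UnifHolder ε β A) (hAB : ∀ i x, A i x * B i x = 1) (hBA : ∀ i x, B i x * A i x = 1)
    {K : ℝ} (hK : ∀ i x, ‖B i x‖ ≤ K) : UnifHolder ε β B := by
  obtain ⟨C, hC, hb, hh⟩ := hA
  refine ⟨max K 0 + max K 0 * C * max K 0, by positivity, fun i x => ?_, fun i j x y => ?_⟩
  · have : 0 ≤ max K 0 * C * max K 0 := by positivity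
    linarith [hK i x, le_max_left K 0]
  · have h0 : 0 ≤ (ε i j + ‖x - y‖) ^ β := by
      have := hε i j
      positivity
    have : B i x - B j y = B i x * (A j y - A i x) * B j y := by
      rw [mul_sub, sub_mul, hBA, mul_assoc, hAB, mul_one, one_mul]
    rw [this]
    have hK' : ∀ i x, ‖B i x‖ ≤ max K 0 := fun i x => (hK i x).trans (le_max_left _ _)
    have h1 : ‖B i x * (A j y - A i x) * B j y‖
        ≤ max K 0 * (C * (ε i j + ‖x - y‖) ^ β) * max K 0 := by
      refine (norm_mul_le _ _).trans ?_
      gcongr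
      · refine (norm_mul_le _ _).trans ?_
        gcongr
        · exact hK' i x
        · rw [norm_sub_rev]
          exact hh i j x y
      · exact hK' j y
    have : 0 ≤ max K 0 * (ε i j + ‖x - y‖) ^ β := by positivity
    linarith

theorem UnifHolderN.inverse {R : Type u} [NormedRing R] [NormedAlgebra ℝ R]
    [CompleteSpace R] (hε : ∀ i j, 0 ≤ ε i j) {n : ℕ}
    {A B : ι → E → R}
    (hA : UnifHolderN ε β n A) (hAB : ∀ i x, A i x * B i x = 1) (hBA : ∀ i x, B i x * A i x = 1)
    {K : ℝ} (hK : ∀ i x, ‖B i x‖ ≤ K) : UnifHolderN ε β n B := by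
  induction n with
  | zero => exact UnifHolder.inverse hε hA hAB hBA hK
  | succ n ih =>
    have hd : ∀ i x, HasFDerivAt (B i)
        ((-ContinuousLinearMap.mulLeftRight ℝ R (B i x) (B i x)).comp
          (fderiv ℝ (A i) x)) x := fun i x => by
      let U : ι → E → Rˣ := fun i x => ⟨A i x, B i x, hAB i x, hBA i x⟩
      have h1 : B i = Ring.inverse ∘ A i := by
        ext1 y
        exact (Ring.inverse_unit (U i y)).symm
      have h2 := (hasFDerivAt_ringInverse (𝕜 := ℝ) (U i x)).comp x (hA.2.1 i x).hasFDerivAt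
      rw [← h1] at h2
      exact h2
    refine ⟨hA.1.inverse hε hAB hBA hK, fun i x => (hd i x).differentiableAt, ?_⟩
    have hB := ih hA.of_succ
    have hBB : UnifHolderN ε β n (F := R →L[ℝ] R) fun i x =>
        -ContinuousLinearMap.mulLeftRight ℝ R (B i x) (B i x) :=
      (UnifHolderN.bilin hε (ContinuousLinearMap.mulLeftRight ℝ R) hB hB).neg
    convert UnifHolderN.bilin (F := R →L[ℝ] R) (G := E →L[ℝ] R)
      (H := E →L[ℝ] R) hε (ContinuousLinearMap.compL ℝ E R R)
      hBB hA.2.2 using 3 with i x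
    exact (hd i x).fderiv

theorem unifHolder_isometry {f : ι → E → F} {g : ι → E → G}
    (h0 : ∀ i x, ‖f i x‖ = ‖g i x‖) (h1 : ∀ i j x y, ‖f i x - f j y‖ = ‖g i x - g j y‖) :
    UnifHolder ε β f ↔ UnifHolder ε β g := by
  simp only [UnifHolder, h0, h1]

theorem unifHolder_iteratedFDeriv_succ {l : ℕ} {f : ι → E → F} :
    UnifHolder ε β (fun i => iteratedFDeriv ℝ (l + 1) (f i)) ↔
      UnifHolder ε β (fun i => iteratedFDeriv ℝ l (fderiv ℝ (f i))) := by
  refine unifHolder_isometry (fun i x => norm_iteratedFDeriv_fderiv.symm) fun i j x y => ?_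
  simp only [iteratedFDeriv_succ_eq_comp_right, Function.comp_apply, ← dist_eq_norm,
    LinearIsometryEquiv.dist_map]

theorem unifHolder_iteratedFDeriv_zero {f : ι → E → F} :
    UnifHolder ε β (fun i => iteratedFDeriv ℝ 0 (f i)) ↔ UnifHolder ε β f := by
  refine unifHolder_isometry (fun i x => by simp) fun i j x y => ?_
  simp only [iteratedFDeriv_zero_eq_comp, Function.comp_apply, ← dist_eq_norm,
    LinearIsometryEquiv.dist_map]

theorem UnifHolder.continuous (hε : ∀ i, ε i i = 0) (hβ : 0 < β) {f : ι → E → F}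
    (hf : UnifHolder ε β f) (i : ι) : Continuous (f i) := by
  obtain ⟨C, hC, -, hh⟩ := hf
  refine continuous_iff_continuousAt.2 fun y => tendsto_iff_norm_sub_tendsto_zero.2 ?_
  have h1 : Tendsto (fun x => C * ‖x - y‖ ^ β) (𝓝 y) (𝓝 0) := by
    have h2 : Continuous fun x : E => C * ‖x - y‖ ^ β := by
      have := hβ.le
      fun_prop (disch := assumption)
    simpa [Real.zero_rpow hβ.ne'] using h2.tendsto y
  refine squeeze_zero (fun _ => norm_nonneg _) (fun x => ?_) h1
  simpa [hε] using hh i i x y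

theorem unifHolderN_iff (hε : ∀ i, ε i i = 0) (hβ : 0 < β) {n : ℕ} {f : ι → E → F} :
    UnifHolderN ε β n f ↔ (∀ i, ContDiff ℝ n (f i)) ∧
      (∀ l ≤ n, UnifHolder ε β (fun i => iteratedFDeriv ℝ l (f i))) := by
  induction n generalizing F with
  | zero =>
    simp only [UnifHolderN, Nat.le_zero, forall_eq, unifHolder_iteratedFDeriv_zero,
      Nat.cast_zero, contDiff_zero]
    exact ⟨fun h => ⟨h.continuous hε hβ, h⟩, And.right⟩
  | succ n ih =>
    have h1 : (∀ l ≤ n + 1, UnifHolder ε β (fun i => iteratedFDeriv ℝ l (f i))) ↔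
        UnifHolder ε β f ∧
          ∀ l ≤ n, UnifHolder ε β (fun i => iteratedFDeriv ℝ l (fderiv ℝ (f i))) := by
      constructor
      · exact fun h => ⟨unifHolder_iteratedFDeriv_zero.1 (h 0 (by omega)),
          fun l hl => unifHolder_iteratedFDeriv_succ.1 (h (l + 1) (by omega))⟩
      · rintro ⟨h, h'⟩ (_ | l) hl
        · exact unifHolder_iteratedFDeriv_zero.2 h
        · exact unifHolder_iteratedFDeriv_succ.2 (h' l (by omega))
    have h2 : ∀ i, ContDiff ℝ ((n + 1 : ℕ) : WithTop ℕ∞) (f i) ↔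
        Differentiable ℝ (f i) ∧ ContDiff ℝ n (fderiv ℝ (f i)) := fun i => by
      push_cast
      rw [contDiff_succ_iff_fderiv]
      simp
    simp only [UnifHolderN, ih, h1, h2, forall_and]
    tauto

end UniformHolder

section HolderNorm

variable {E F : Type*} [NormedAddCommGroup E] [NormedSpace ℝ E]
  [NormedAddCommGroup F] [NormedSpace ℝ F] {n : ℕ} {α β : ℝ} {f g : E → F}

theorem hnorm_nonneg : 0 ≤ hnorm n α f := ENNReal.toReal_nonneg

theorem norm_iteratedFDeriv_le_hnorm (h : eHnorm n α f < ⊤) {l : ℕ} (hl : l ≤ n) (x : E) :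
    ‖iteratedFDeriv ℝ l f x‖ ≤ hnorm n α f := by
  have h1 : (‖iteratedFDeriv ℝ l f x‖₊ : ℝ≥0∞) ≤ eHnorm n α f :=
    le_max_of_le_left (le_iSup₂ (f := fun (l : Fin (n + 1)) (x : E) =>
      (‖iteratedFDeriv ℝ (l : ℕ) f x‖₊ : ℝ≥0∞)) ⟨l, by omega⟩ x)
  simpa [hnorm] using ENNReal.toReal_mono h.ne h1

theorem norm_iteratedFDeriv_sub_le_hnorm (h : eHnorm n α f < ⊤) (x y : E) :
    ‖iteratedFDeriv ℝ n f x - iteratedFDeriv ℝ n f y‖ ≤ hnorm n α f * ‖x - y‖ ^ α := by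
  rcases eq_or_ne x y with rfl | hxy
  · have := hnorm_nonneg (n := n) (α := α) (f := f)
    rw [sub_self, norm_zero]
    positivity
  have hpos : 0 < ‖x - y‖ := norm_pos_iff.2 (sub_ne_zero.2 hxy)
  have h1 : (‖iteratedFDeriv ℝ n f x - iteratedFDeriv ℝ n f y‖₊ : ℝ≥0∞) / edist x y ^ α
      ≤ eHnorm n α f :=
    le_max_of_le_right (le_iSup₂_of_le x y (le_iSup_of_le hxy le_rfl))
  have h2 := ENNReal.toReal_mono h.ne h1
  rw [ENNReal.toReal_div, ← ENNReal.toReal_rpow, ← dist_edist, dist_eq_norm] at h2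
  exact (div_le_iff₀ (by positivity)).1 h2

theorem eHnorm_le_ofReal {C : ℝ} (hb : ∀ l ≤ n, ∀ x, ‖iteratedFDeriv ℝ l f x‖ ≤ C)
    (hh : ∀ x y, ‖iteratedFDeriv ℝ n f x - iteratedFDeriv ℝ n f y‖ ≤ C * ‖x - y‖ ^ α) :
    eHnorm n α f ≤ ENNReal.ofReal C := by
  refine max_le (iSup₂_le fun l x => ?_) (iSup₂_le fun x y => iSup_le fun hxy => ?_)
  · rw [← ENNReal.ofReal_coe_nnreal]
    exact ENNReal.ofReal_le_ofReal (hb l (by omega) x)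
  · have hpos : 0 < ‖x - y‖ := norm_pos_iff.2 (sub_ne_zero.2 hxy)
    rw [edist_dist, dist_eq_norm, ENNReal.ofReal_rpow_of_pos hpos, ← ENNReal.ofReal_coe_nnreal,
      ← ENNReal.ofReal_div_of_pos (by positivity)]
    exact ENNReal.ofReal_le_ofReal ((div_le_iff₀ (by positivity)).2 (hh x y))

theorem hnorm_le {C : ℝ} (hC : 0 ≤ C) (hb : ∀ l ≤ n, ∀ x, ‖iteratedFDeriv ℝ l f x‖ ≤ C)
    (hh : ∀ x y, ‖iteratedFDeriv ℝ n f x - iteratedFDeriv ℝ n f y‖ ≤ C * ‖x - y‖ ^ α) :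
    hnorm n α f ≤ C :=
  ENNReal.toReal_le_of_le_ofReal hC (eHnorm_le_ofReal hb hh)

theorem MemCb.contDiff_of_le (hf : MemCb n α f) {l : ℕ} (hl : l ≤ n) : ContDiff ℝ l f :=
  hf.1.of_le (by exact_mod_cast hl)

theorem MemCb.iteratedFDeriv_sub (hf : MemCb n α f) (hg : MemCb n α g) {l : ℕ} (hl : l ≤ n)
    (x : E) :
    iteratedFDeriv ℝ l (f - g) x = iteratedFDeriv ℝ l f x - iteratedFDeriv ℝ l g x :=
  iteratedFDeriv_sub_apply (hf.contDiff_of_le hl).contDiffAt (hg.contDiff_of_le hl).contDiffAt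

theorem MemCb.eHnorm_sub_le (hf : MemCb n α f) (hg : MemCb n α g) :
    eHnorm n α (f - g) ≤ ENNReal.ofReal (hnorm n α f + hnorm n α g) := by
  refine eHnorm_le_ofReal (fun l hl x => ?_) (fun x y => ?_)
  · rw [hf.iteratedFDeriv_sub hg hl]
    exact (norm_sub_le _ _).trans (add_le_add (norm_iteratedFDeriv_le_hnorm hf.2 hl x)
      (norm_iteratedFDeriv_le_hnorm hg.2 hl x))
  · rw [hf.iteratedFDeriv_sub hg le_rfl, hf.iteratedFDeriv_sub hg le_rfl, sub_sub_sub_comm, add_mul]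
    exact (norm_sub_le _ _).trans (add_le_add (norm_iteratedFDeriv_sub_le_hnorm hf.2 x y)
      (norm_iteratedFDeriv_sub_le_hnorm hg.2 x y))

theorem MemCb.sub (hf : MemCb n α f) (hg : MemCb n α g) : MemCb n α (f - g) :=
  ⟨hf.1.sub hg.1, (hf.eHnorm_sub_le hg).trans_lt ENNReal.ofReal_lt_top⟩

theorem MemCb.hnorm_sub_le (hf : MemCb n α f) (hg : MemCb n α g) :
    hnorm n α (f - g) ≤ hnorm n α f + hnorm n α g :=
  ENNReal.toReal_le_of_le_ofReal (add_nonneg hnorm_nonneg hnorm_nonneg) (hf.eHnorm_sub_le hg)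

theorem MemCb.hnorm_le_add (hf : MemCb n α f) (hg : MemCb n α g) :
    hnorm n α f ≤ hnorm n α g + hnorm n α (f - g) := by
  have hsplit : ∀ l ≤ n, ∀ x, iteratedFDeriv ℝ l f x
      = iteratedFDeriv ℝ l g x + iteratedFDeriv ℝ l (f - g) x := fun l hl x => by
    rw [hf.iteratedFDeriv_sub hg hl, add_sub_cancel]
  refine hnorm_le (add_nonneg hnorm_nonneg hnorm_nonneg) (fun l hl x => ?_) (fun x y => ?_)
  · rw [hsplit l hl]
    exact (norm_add_le _ _).trans (add_le_add (norm_iteratedFDeriv_le_hnorm hg.2 hl x)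
      (norm_iteratedFDeriv_le_hnorm (hf.sub hg).2 hl x))
  · rw [hsplit n le_rfl, hsplit n le_rfl, add_sub_add_comm, add_mul]
    exact (norm_add_le _ _).trans (add_le_add (norm_iteratedFDeriv_sub_le_hnorm hg.2 x y)
      (norm_iteratedFDeriv_sub_le_hnorm (hf.sub hg).2 x y))

theorem le_two_mul_mul_rpow {R t a u : ℝ} (hR : 0 ≤ R) (ht : 0 ≤ t) (ha : 0 ≤ a) (h1 : u ≤ 2 * R)
    (h2 : t ≤ 1 → u ≤ R * t ^ a) : u ≤ 2 * R * t ^ a := by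
  rcases le_total t 1 with h | h
  · have : 0 ≤ R * t ^ a := by positivity
    linarith [h2 h]
  · exact h1.trans (le_mul_of_one_le_right (by positivity) (Real.one_le_rpow h ha))

theorem norm_iteratedFDeriv_sub_le_of_le (hα : 0 < α) (hαβ : α ≤ β) (hf : eHnorm n β f < ⊤)
    (x y : E) :
    ‖iteratedFDeriv ℝ n f x - iteratedFDeriv ℝ n f y‖ ≤ 2 * hnorm n β f * ‖x - y‖ ^ α := by
  refine le_two_mul_mul_rpow hnorm_nonneg (norm_nonneg _) hα.le ?_ fun h => ?_
  · have := norm_sub_le (iteratedFDeriv ℝ n f x) (iteratedFDeriv ℝ n f y)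
    linarith [norm_iteratedFDeriv_le_hnorm hf le_rfl x, norm_iteratedFDeriv_le_hnorm hf le_rfl y]
  · refine (norm_iteratedFDeriv_sub_le_hnorm hf x y).trans ?_
    exact mul_le_mul_of_nonneg_left
      (Real.rpow_le_rpow_of_exponent_ge_of_imp (norm_nonneg _) h hαβ
        fun _ h0 => absurd h0 (hα.trans_le hαβ).ne')
      hnorm_nonneg

theorem MemCb.of_exponent_le (hα : 0 < α) (hαβ : α ≤ β) (hf : MemCb n β f) :
    MemCb n α f ∧ hnorm n α f ≤ 2 * hnorm n β f := by
  have h0 : 0 ≤ hnorm n β f := hnorm_nonneg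
  have hb : ∀ l ≤ n, ∀ x, ‖iteratedFDeriv ℝ l f x‖ ≤ 2 * hnorm n β f := fun l hl x => by
    linarith [norm_iteratedFDeriv_le_hnorm hf.2 hl x]
  have hh := norm_iteratedFDeriv_sub_le_of_le hα hαβ hf.2
  exact ⟨⟨hf.1, (eHnorm_le_ofReal hb hh).trans_lt ENNReal.ofReal_lt_top⟩,
    hnorm_le (by positivity) hb hh⟩

/-- Derivatives up to order `n` of a `C^{n,β}` function are globally `β`-Hölder. -/
theorem MemCb.norm_iteratedFDeriv_sub_le (hβ : 0 < β) (hβ1 : β ≤ 1) (hf : MemCb n β f) {l : ℕ}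
    (hl : l ≤ n) (x y : E) :
    ‖iteratedFDeriv ℝ l f x - iteratedFDeriv ℝ l f y‖ ≤ 2 * hnorm n β f * ‖x - y‖ ^ β := by
  rcases hl.eq_or_lt with rfl | hl'
  · exact norm_iteratedFDeriv_sub_le_of_le hβ le_rfl hf.2 x y
  refine le_two_mul_mul_rpow hnorm_nonneg (norm_nonneg _) hβ.le ?_ fun h => ?_
  · have := norm_sub_le (iteratedFDeriv ℝ l f x) (iteratedFDeriv ℝ l f y)
    linarith [norm_iteratedFDeriv_le_hnorm hf.2 hl x, norm_iteratedFDeriv_le_hnorm hf.2 hl y]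
  · have h1 : ‖iteratedFDeriv ℝ l f x - iteratedFDeriv ℝ l f y‖ ≤ hnorm n β f * ‖x - y‖ := by
      refine Convex.norm_image_sub_le_of_norm_fderiv_le (𝕜 := ℝ) (s := univ)
        (fun z _ => ?_) (fun z _ => ?_) convex_univ (mem_univ y) (mem_univ x)
      · exact (hf.contDiff_of_le (l := l + 1) hl').differentiable_iteratedFDeriv
          (by exact_mod_cast Nat.lt_succ_self l) z
      · rw [norm_fderiv_iteratedFDeriv]
        exact norm_iteratedFDeriv_le_hnorm hf.2 hl' z
    refine h1.trans (mul_le_mul_of_nonneg_left ?_ hnorm_nonneg)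
    exact Real.self_le_rpow_of_le_one (norm_nonneg _) h hβ1

end HolderNorm

section GlobalInverse

set_option linter.unusedSectionVars false

variable {E : Type*} [NormedAddCommGroup E] [NormedSpace ℝ E]

theorem isClosed_setOf_fiber_pairs {Φ : E → E} (hc : Continuous Φ)
    (hloc : ∀ x, ∃ U ∈ 𝓝 x, InjOn Φ U) :
    IsClosed {p : E × E | Φ p.1 = Φ p.2 ∧ p.1 ≠ p.2} := by
  rw [← isOpen_compl_iff, isOpen_iff_mem_nhds]
  rintro ⟨x, y⟩ hp
  by_cases h : Φ x = Φ y
  · obtain rfl : x = y := by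
      by_contra hne
      exact hp ⟨h, hne⟩
    obtain ⟨U, hU, hinj⟩ := hloc x
    filter_upwards [prod_mem_nhds hU hU] with q hq hq'
    exact hq'.2 (hinj hq.1 hq.2 hq'.1)
  · have : {p : E × E | Φ p.1 ≠ Φ p.2} ∈ 𝓝 (x, y) :=
      (isOpen_ne_fun (hc.comp continuous_fst) (hc.comp continuous_snd)).mem_nhds h
    filter_upwards [this] with q hq hq'
    exact hq hq'.1

variable [FiniteDimensional ℝ E]

/-- A bounded perturbation of the identity which is a local diffeomorphism and whose derivative
is close to the identity far away is bijective. -/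
theorem bijective_id_add {φ : E → E} {R r : ℝ} (hR : ∀ x, ‖φ x‖ ≤ R) (hd : Differentiable ℝ φ)
    (hr : ∀ x, r < ‖x‖ → ‖fderiv ℝ φ x‖ ≤ 1 / 2)
    (hs : ∀ x, ∃ A : E ≃L[ℝ] E, HasStrictFDerivAt (fun y => y + φ y) (A : E →L[ℝ] E) x) :
    Bijective fun y => y + φ y := by
  have : ProperSpace E := FiniteDimensional.proper ℝ E
  set Φ : E → E := fun y => y + φ y with hΦ
  have hc : Continuous Φ := continuous_id.add hd.continuous
  have hR0 : 0 ≤ R := (norm_nonneg _).trans (hR 0)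
  have hopen : IsOpenMap Φ := by
    refine isOpenMap_iff_nhds_le.2 fun x => ?_
    obtain ⟨A, hA⟩ := hs x
    exact hA.map_nhds_eq_of_equiv.ge
  have hloc : ∀ x, ∃ U ∈ 𝓝 x, InjOn Φ U := fun x => by
    obtain ⟨A, hA⟩ := hs x
    exact ⟨_, (hA.toOpenPartialHomeomorph Φ).open_source.mem_nhds
      hA.mem_toOpenPartialHomeomorph_source, (hA.toOpenPartialHomeomorph Φ).injOn⟩
  have hbd : ∀ x, ‖x - Φ x‖ ≤ R := fun x => by simpa [hΦ] using hR x
  have hbd' : ∀ x, ‖x‖ ≤ ‖Φ x‖ + R := fun x => by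
    have := norm_sub_norm_le x (Φ x)
    linarith [hbd x]
  have hproper : Tendsto Φ (cocompact E) (cocompact E) := by
    rw [← Metric.cobounded_eq_cocompact, ← comap_norm_atTop, tendsto_comap_iff]
    refine tendsto_atTop_mono (fun x => ?_) (tendsto_atTop_add_const_right _ (-R) tendsto_comap)
    simp only [Function.comp]
    linarith [hbd' x]
  have hclosed : IsClosedMap Φ := (isProperMap_iff_tendsto_cocompact.2 ⟨hc, hproper⟩).isClosedMap
  refine ⟨?_, ?_⟩
  · rcases subsingleton_or_nontrivial E with _ | _
    · exact injective_of_subsingleton _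
    set S : Set E := (fun p : E × E => Φ p.1) '' {p : E × E | Φ p.1 = Φ p.2 ∧ p.1 ≠ p.2} with hS
    have hSo : IsOpen S := by
      refine isOpen_iff_mem_nhds.2 ?_
      rintro _ ⟨⟨x, x'⟩, ⟨he, hne⟩, rfl⟩
      obtain ⟨U, V, hU, hV, hxU, hxV, hUV⟩ := t2_separation hne
      have h1 := hopen.image_mem_nhds (hU.mem_nhds hxU)
      have h2 := hopen.image_mem_nhds (hV.mem_nhds hxV)
      simp only at he hxV h1 h2 ⊢
      rw [← he] at h2
      filter_upwards [h1, h2]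
      rintro _ ⟨u, hu, rfl⟩ ⟨v, hv, hvu⟩
      exact ⟨(u, v), ⟨hvu.symm, fun h => disjoint_left.1 hUV hu (by rwa [show u = v from h])⟩, rfl⟩
    have hSc : IsClosed S := by
      refine isClosed_of_closure_subset fun y hy => ?_
      obtain ⟨u, hu, hlim⟩ := mem_closure_iff_seq_limit.1 hy
      choose p hp hpu using hu
      obtain ⟨M, hM⟩ := (Metric.isBounded_range_of_tendsto u hlim).exists_norm_le
      have hM' : ∀ k, ‖u k‖ ≤ M := fun k => hM _ (mem_range_self k)
      have hpb : ∀ k, p k ∈ Metric.closedBall (0 : E × E) (M + R) := fun k => by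
        rw [mem_closedBall_zero_iff, Prod.norm_def]
        have h1 : Φ (p k).1 = u k := hpu k
        have h2 : Φ (p k).2 = u k := (hp k).1.symm.trans h1
        refine max_le ?_ ?_
        · linarith [hbd' (p k).1, hM' k, congrArg norm h1]
        · linarith [hbd' (p k).2, hM' k, congrArg norm h2]
      obtain ⟨q, -, s, hs, hq⟩ := (isCompact_closedBall (0 : E × E) (M + R)).tendsto_subseq hpb
      refine ⟨q, (isClosed_setOf_fiber_pairs hc hloc).mem_of_tendsto hq
        (Eventually.of_forall fun k => hp (s k)), ?_⟩
      refine tendsto_nhds_unique (((hc.comp continuous_fst).tendsto q).comp hq) ?_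
      have : (Φ ∘ Prod.fst) ∘ p ∘ s = u ∘ s := funext fun k => hpu (s k)
      rw [this]
      exact hlim.comp hs.tendsto_atTop
    rcases isClopen_iff.1 ⟨hSc, hSo⟩ with h | h
    · intro x x' hxx
      by_contra hne
      have : Φ x ∈ S := ⟨(x, x'), ⟨hxx, hne⟩, rfl⟩
      simp [h] at this
    · exfalso
      obtain ⟨y, hy⟩ := NormedSpace.exists_lt_norm ℝ E (r + R)
      obtain ⟨⟨x, x'⟩, ⟨he, hne⟩, hxy⟩ : y ∈ S := h ▸ mem_univ y
      simp only at he hne hxy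
      have hx : x ∈ Metric.closedBall y R := by
        rw [mem_closedBall_iff_norm, ← hxy]
        exact hbd x
      have hx' : x' ∈ Metric.closedBall y R := by
        rw [mem_closedBall_iff_norm, ← hxy, he]
        exact hbd x'
      have h1 : ‖φ x' - φ x‖ ≤ 1 / 2 * ‖x' - x‖ := by
        refine Convex.norm_image_sub_le_of_norm_fderiv_le (𝕜 := ℝ) (fun z _ => hd z)
          (fun z hz => hr z ?_) (convex_closedBall y R) hx hx'
        rw [mem_closedBall_iff_norm, norm_sub_rev] at hz
        have := norm_sub_norm_le y z
        linarith
      have h2 : φ x' - φ x = x - x' := by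
        have : x + φ x = x' + φ x' := he
        rw [sub_eq_sub_iff_add_eq_add, add_comm (φ x'), this, add_comm]
      rw [h2, norm_sub_rev] at h1
      have : 0 < ‖x' - x‖ := norm_pos_iff.2 (sub_ne_zero.2 (Ne.symm hne))
      linarith
  · rw [← range_eq_univ]
    exact IsClopen.eq_univ ⟨hclosed.isClosed_range, hopen.isOpen_range⟩ (range_nonempty Φ)

theorem exists_equiv_of_le_norm {c : ℝ} (hc : 0 < c) {T : E →L[ℝ] E}
    (hT : ∀ v, c * ‖v‖ ≤ ‖T v‖) :
    ∃ A : E ≃L[ℝ] E, (A : E →L[ℝ] E) = T ∧ ‖(A.symm : E →L[ℝ] E)‖ ≤ c⁻¹ := by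
  have hinj : Injective (T : E →ₗ[ℝ] E) := by
    rw [injective_iff_map_eq_zero]
    intro v hv
    have h1 := hT v
    rw [show T v = 0 from hv, norm_zero] at h1
    exact norm_le_zero_iff.1 (nonpos_of_mul_nonpos_right h1 hc)
  refine ⟨(LinearEquiv.ofInjectiveEndo (T : E →ₗ[ℝ] E) hinj).toContinuousLinearEquiv, ?_, ?_⟩
  · ext v
    simp
  · refine ContinuousLinearMap.opNorm_le_bound _ (by positivity) fun v => ?_
    rw [inv_mul_eq_div, le_div_iff₀ hc, mul_comm]
    refine (hT _).trans (le_of_eq ?_)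
    congr 1
    exact LinearEquiv.apply_symm_apply (LinearEquiv.ofInjectiveEndo (T : E →ₗ[ℝ] E) hinj) v

theorem ContinuousLinearMap.det_ne_zero_of_le_norm {c : ℝ} (hc : 0 < c) {T : E →L[ℝ] E}
    (hT : ∀ v, c * ‖v‖ ≤ ‖T v‖) : T.det ≠ 0 := by
  obtain ⟨A, rfl, -⟩ := exists_equiv_of_le_norm hc hT
  exact (LinearEquiv.isUnit_det' A.toLinearEquiv).ne_zero

theorem le_norm_of_norm_sub_le {c ρ : ℝ} {S T : E →L[ℝ] E} (hS : ∀ v, c * ‖v‖ ≤ ‖S v‖)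
    (hST : ‖T - S‖ ≤ ρ) (v : E) : (c - ρ) * ‖v‖ ≤ ‖T v‖ := by
  have h1 : ‖(T - S) v‖ ≤ ρ * ‖v‖ := (T - S).le_of_opNorm_le hST v
  rw [sub_apply, norm_sub_rev] at h1
  have := norm_sub_norm_le (S v) (T v)
  linarith [hS v]

theorem ContinuousLinearMap.det_pos_of_norm_sub_lt {c : ℝ} {S T : E →L[ℝ] E}
    (hS : ∀ v, c * ‖v‖ ≤ ‖S v‖) (hdet : 0 < S.det) (hST : ‖T - S‖ < c) : 0 < T.det := by
  have hcont : Continuous fun t : ℝ => (S + t • (T - S)).det :=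
    ContinuousLinearMap.continuous_det.comp (by fun_prop)
  by_contra! hneg
  have h0 : (0 : ℝ) ∈ Icc ((S + (1 : ℝ) • (T - S)).det) ((S + (0 : ℝ) • (T - S)).det) :=
    ⟨by simpa using hneg, by simpa using hdet.le⟩
  obtain ⟨t, ht, hzero⟩ := intermediate_value_Icc' zero_le_one hcont.continuousOn h0
  refine ContinuousLinearMap.det_ne_zero_of_le_norm (sub_pos.2 hST)
    (le_norm_of_norm_sub_le hS ?_) hzero
  rw [add_sub_cancel_left, norm_smul, Real.norm_of_nonneg ht.1]
  exact mul_le_of_le_one_left (norm_nonneg _) ht.2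

/-- Continuous invertible linear perturbations of the identity vanishing at infinity are
uniformly bounded below. -/
theorem exists_uniform_le_norm {P : E → E →L[ℝ] E} (hP : Continuous P)
    (h0 : Tendsto (fun x => ‖P x‖) (cocompact E) (𝓝 0)) (hdet : ∀ x, 0 < (1 + P x).det) :
    ∃ c > 0, ∀ x v, c * ‖v‖ ≤ ‖(1 + P x) v‖ := by
  have hev : ∀ᶠ x in cocompact E, ‖P x‖ < 1 / 2 := h0.eventually (gt_mem_nhds (by norm_num))
  obtain ⟨K, hK, hKs⟩ := mem_cocompact.1 hev
  have hu : ∀ x, IsUnit (1 + P x) := fun x =>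
    ((1 + P x).toContinuousLinearEquivOfDetNeZero (hdet x).ne').toUnit.isUnit
  have hinv : Continuous fun x => Ring.inverse (1 + P x) :=
    continuous_iff_continuousAt.2 fun x => by
      obtain ⟨U, hU⟩ := hu x
      have h1 := NormedRing.inverse_continuousAt U
      rw [hU] at h1
      exact ContinuousAt.comp (f := fun x => 1 + P x) h1 (by fun_prop)
  obtain ⟨C, hC⟩ := hK.exists_bound_of_continuousOn hinv.continuousOn
  have hpos : 0 < |C| + 1 := by positivity
  refine ⟨min (1 / 2) (|C| + 1)⁻¹, lt_min (by norm_num) (by positivity), fun x v => ?_⟩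
  by_cases hx : x ∈ K
  · have h1 : v = Ring.inverse (1 + P x) ((1 + P x) v) := by
      rw [← mul_apply_eq_comp, Ring.inverse_mul_cancel _ (hu x)]
      rfl
    have h2 : ‖v‖ ≤ (|C| + 1) * ‖(1 + P x) v‖ := by
      nth_rewrite 1 [h1]
      refine ContinuousLinearMap.le_of_opNorm_le _ ?_ _
      linarith [hC x hx, le_abs_self C]
    calc min (1 / 2) (|C| + 1)⁻¹ * ‖v‖ ≤ (|C| + 1)⁻¹ * ‖v‖ := by
          gcongr
          exact min_le_right _ _
      _ ≤ _ := by rwa [inv_mul_le_iff₀ hpos]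
  · have h1 : ‖P x‖ < 1 / 2 := hKs hx
    have h2 := le_norm_of_norm_sub_le (c := 1) (ρ := 1 / 2) (S := 1) (T := 1 + P x)
      (fun v => by simp) (by simpa using h1.le) v
    calc min (1 / 2) (|C| + 1)⁻¹ * ‖v‖ ≤ (1 - 1 / 2) * ‖v‖ := by
          gcongr
          exact (min_le_left _ _).trans (by norm_num)
      _ ≤ _ := h2

end GlobalInverse

section Inversion

theorem norm_inverse_sub_le {ι E : Type*} [NormedAddCommGroup E] [NormedSpace ℝ E]
    {ε : ι → ι → ℝ} {φ g : ι → E → E} {B : ι → E → E →L[ℝ] E} {K : ℝ}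
    (hr : ∀ i x, g i x + φ i (g i x) = x) (hl : ∀ i x, g i (x + φ i x) = x)
    (hg : ∀ i x, HasFDerivAt (g i) (B i x) x) (hK : ∀ i x, ‖B i x‖ ≤ K)
    (hφε : ∀ i j x, ‖φ i x - φ j x‖ ≤ ε i j) (i j : ι) (x y : E) :
    ‖g i x - g j y‖ ≤ K * (ε i j + ‖x - y‖) := by
  have hlip : ∀ x y, ‖g i x - g i y‖ ≤ K * ‖x - y‖ := fun x y =>
    Convex.norm_image_sub_le_of_norm_hasFDerivWithin_le (𝕜 := ℝ)
      (fun z _ => (hg i z).hasFDerivWithinAt) (fun z _ => hK i z) convex_univ (mem_univ y)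
      (mem_univ x)
  have hK0 : 0 ≤ K := (norm_nonneg _).trans (hK i x)
  have h1 : ‖g i y - g j y‖ ≤ K * ε i j := by
    have h2 := hlip y (g j y + φ i (g j y))
    rw [hl i (g j y)] at h2
    refine h2.trans (mul_le_mul_of_nonneg_left ?_ hK0)
    have h3 : y - (g j y + φ i (g j y)) = φ j (g j y) - φ i (g j y) := by
      nth_rewrite 1 [← hr j y]
      abel
    rw [h3, norm_sub_rev]
    exact hφε i j _
  have h4 := norm_sub_le_norm_sub_add_norm_sub (g i x) (g i y) (g j y)
  linarith [hlip x y]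

universe u v

/-- Inverses of a uniformly Hölder family of perturbations of the identity, with uniformly bounded
inverse derivatives, form a uniformly Hölder family of perturbations of the identity. -/
theorem UnifHolderN.inverse_id_add {ι : Type v} {E : Type u} [NormedAddCommGroup E]
    [NormedSpace ℝ E] [CompleteSpace E] {ε : ι → ι → ℝ} {β : ℝ} (hε : ∀ i j, 0 ≤ ε i j)
    (hβ : 0 ≤ β) {n : ℕ} {φ g : ι → E → E} {B : ι → E → E →L[ℝ] E} {K : ℝ} (hK0 : 0 ≤ K)
    (hφ : UnifHolderN ε β (n + 1) φ)
    (hr : ∀ i x, g i x + φ i (g i x) = x) (hl : ∀ i x, g i (x + φ i x) = x)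
    (hg : ∀ i x, HasFDerivAt (g i) (B i x) x) (hK : ∀ i x, ‖B i x‖ ≤ K)
    (hAB : ∀ i x, (1 + fderiv ℝ (φ i) (g i x)) * B i x = 1)
    (hBA : ∀ i x, B i x * (1 + fderiv ℝ (φ i) (g i x)) = 1)
    (hφε : ∀ i j x, ‖φ i x - φ j x‖ ≤ ε i j) :
    UnifHolderN ε β (n + 1) (fun i x => g i x - x) := by
  have hlip := norm_inverse_sub_le hr hl hg hK hφε
  have hgd : ∀ i, Differentiable ℝ (g i) := fun i x => (hg i x).differentiableAt
  have hgB : (fun i => fderiv ℝ (g i)) = B := funext fun i => funext fun x => (hg i x).fderiv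
  have hA : UnifHolderN ε β n (fun i x => 1 + fderiv ℝ (φ i) x) :=
    (UnifHolderN.const hε n (1 : E →L[ℝ] E)).add hφ.2.2
  have key : ∀ k ≤ n, UnifHolderN ε β k (fun i => fderiv ℝ (g i)) := by
    intro k
    induction k using Nat.strong_induction_on with
    | _ k ih =>
      intro hk
      have h1 := (hA.mono hk).comp hε hβ hK0 hlip hgd fun m hm => ih m hm (by omega)
      rw [hgB]
      exact h1.inverse hε hAB hBA hK
  have h2 := (hφ.comp hε hβ hK0 hlip hgd fun m hm => key m (by omega)).neg
  convert h2 using 3 with i x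
  nth_rewrite 2 [← hr i x]
  abel

variable {E : Type*} [NormedAddCommGroup E] [NormedSpace ℝ E] {n : ℕ} {α β : ℝ}

/-- Interpolation between a `C^n`-bound by `t ^ β` and a bounded `β`-Hölder seminorm. -/
theorem hnorm_sub_le_of_interpolation {f g : E → E} {C t T : ℝ} (hα : 0 < α) (hαβ : α < β)
    (hC : 0 ≤ C) (ht : 0 ≤ t) (htT : t ≤ T) (hf : ContDiff ℝ n f) (hg : ContDiff ℝ n g)
    (hfg : ∀ l ≤ n, ∀ x, ‖iteratedFDeriv ℝ l f x - iteratedFDeriv ℝ l g x‖ ≤ C * t ^ β)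
    (hfh : ∀ x y, ‖iteratedFDeriv ℝ n f x - iteratedFDeriv ℝ n f y‖ ≤ C * ‖x - y‖ ^ β)
    (hgh : ∀ x y, ‖iteratedFDeriv ℝ n g x - iteratedFDeriv ℝ n g y‖ ≤ C * ‖x - y‖ ^ β) :
    hnorm n α (f - g) ≤ C * (2 + T ^ α) * t ^ (β - α) := by
  have hT : 0 ≤ T := ht.trans htT
  have hsub : ∀ l ≤ n, ∀ x, iteratedFDeriv ℝ l (f - g) x
      = iteratedFDeriv ℝ l f x - iteratedFDeriv ℝ l g x := fun l hl x =>
    iteratedFDeriv_sub_apply (hf.of_le (by exact_mod_cast hl)).contDiffAt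
      (hg.of_le (by exact_mod_cast hl)).contDiffAt
  have hsplit : ∀ s : ℝ, 0 ≤ s → s ^ β = s ^ (β - α) * s ^ α := fun s hs => by
    rw [← Real.rpow_add_of_nonneg hs (by linarith) hα.le, sub_add_cancel]
  have hta : 0 ≤ t ^ (β - α) := by positivity
  have hTa : 0 ≤ T ^ α := by positivity
  refine hnorm_le (by positivity) (fun l hl x => ?_) (fun x y => ?_)
  · rw [hsub l hl]
    refine (hfg l hl x).trans ?_
    rw [hsplit t ht, mul_assoc]
    refine mul_le_mul_of_nonneg_left ?_ hC
    rw [mul_comm]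
    have : t ^ α ≤ T ^ α := by gcongr
    exact mul_le_mul_of_nonneg_right (by linarith) hta
  · rw [hsub n le_rfl, hsub n le_rfl]
    set s := ‖x - y‖ with hs
    have hs0 : 0 ≤ s := norm_nonneg _
    have hsa : 0 ≤ s ^ α := by positivity
    suffices h : ‖iteratedFDeriv ℝ n f x - iteratedFDeriv ℝ n g x
        - (iteratedFDeriv ℝ n f y - iteratedFDeriv ℝ n g y)‖ ≤ 2 * C * (t ^ (β - α) * s ^ α) by
      have : 0 ≤ C * T ^ α * t ^ (β - α) * s ^ α := by positivity
      linarith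
    rcases le_total t s with h | h
    · have h1 : t ^ β ≤ t ^ (β - α) * s ^ α := by
        rw [hsplit t ht]
        gcongr
      have h2 := norm_sub_le (iteratedFDeriv ℝ n f x - iteratedFDeriv ℝ n g x)
        (iteratedFDeriv ℝ n f y - iteratedFDeriv ℝ n g y)
      have h3 := mul_le_mul_of_nonneg_left h1 hC
      linarith [hfg n le_rfl x, hfg n le_rfl y]
    · have h1 : s ^ β ≤ t ^ (β - α) * s ^ α := by
        rw [hsplit s hs0]
        have := sub_pos.2 hαβ
        gcongr
      rw [sub_sub_sub_comm]
      have h2 := norm_sub_le (iteratedFDeriv ℝ n f x - iteratedFDeriv ℝ n f y)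
        (iteratedFDeriv ℝ n g x - iteratedFDeriv ℝ n g y)
      have h3 := mul_le_mul_of_nonneg_left h1 hC
      linarith [hfh x y, hgh x y]

/-- A bounded family in `C^{n,β}` is uniformly Hölder with respect to any bounded distance
dominating the `C^n`-distance. -/
theorem unifHolderN_of_hnorm_le {ι : Type*} {ε : ι → ι → ℝ} (hε : ∀ i j, 0 ≤ ε i j)
    (hε0 : ∀ i, ε i i = 0) (hβ : 0 < β) (hβ1 : β ≤ 1) {φ : ι → E → E} {R T : ℝ} (hT : 1 ≤ T)
    (hεT : ∀ i j, ε i j ≤ T) (hφ : ∀ i, MemCb n β (φ i)) (hR : ∀ i, hnorm n β (φ i) ≤ R)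
    (hR0 : 0 ≤ R)
    (hφε : ∀ i j, ∀ l ≤ n, ∀ x, ‖iteratedFDeriv ℝ l (φ i - φ j) x‖ ≤ ε i j) :
    UnifHolderN ε β n φ := by
  refine (unifHolderN_iff hε0 hβ).2 ⟨fun i => (hφ i).contDiff_of_le le_rfl, fun l hl =>
    ⟨2 * R + T, by positivity, fun i x => ?_, fun i j x y => ?_⟩⟩
  · linarith [norm_iteratedFDeriv_le_hnorm (hφ i).2 hl x, hR i]
  · have h0 := hε i j
    have h1 : ‖iteratedFDeriv ℝ l (φ i) x - iteratedFDeriv ℝ l (φ i) y‖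
        ≤ 2 * R * (ε i j + ‖x - y‖) ^ β := by
      refine ((hφ i).norm_iteratedFDeriv_sub_le hβ hβ1 hl x y).trans ?_
      gcongr
      · exact hR i
      · linarith
    have h2 : ‖iteratedFDeriv ℝ l (φ i) y - iteratedFDeriv ℝ l (φ j) y‖ ≤ ε i j := by
      rw [← (hφ i).iteratedFDeriv_sub (hφ j) hl]
      exact hφε i j l hl y
    have h3 : ε i j ≤ T * (ε i j) ^ β := by
      rcases le_total (ε i j) 1 with h | h
      · exact (Real.self_le_rpow_of_le_one h0 h hβ1).trans
          (le_mul_of_one_le_left (by positivity) hT)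
      · exact (hεT i j).trans (le_mul_of_one_le_right (by positivity)
          (Real.one_le_rpow h hβ.le))
    have h4 : T * (ε i j) ^ β ≤ T * (ε i j + ‖x - y‖) ^ β := by
      gcongr
      linarith [norm_nonneg (x - y)]
    have h5 := norm_sub_le_norm_sub_add_norm_sub (iteratedFDeriv ℝ l (φ i) x)
      (iteratedFDeriv ℝ l (φ i) y) (iteratedFDeriv ℝ l (φ j) y)
    linarith

end Inversion

section Diffeomorphisms

theorem exists_hasFDerivAt_invFun_id_add {E : Type*} [NormedAddCommGroup E] [NormedSpace ℝ E]
    [FiniteDimensional ℝ E] {φ : E → E} {R c : ℝ} (hφ : ContDiff ℝ 1 φ)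
    (hR : ∀ x, ‖φ x‖ ≤ R) (h0 : Tendsto (fun x => ‖fderiv ℝ φ x‖) (cocompact E) (𝓝 0))
    (hc : 0 < c) (hlow : ∀ x v, c * ‖v‖ ≤ ‖(1 + fderiv ℝ φ x) v‖) :
    Bijective (fun y => y + φ y) ∧ ∃ B : E → E →L[ℝ] E, ∀ x,
      HasFDerivAt (invFun fun y => y + φ y) (B x) x ∧ ‖B x‖ ≤ c⁻¹ ∧
      (1 + fderiv ℝ φ (invFun (fun y => y + φ y) x)) * B x = 1 ∧
      B x * (1 + fderiv ℝ φ (invFun (fun y => y + φ y) x)) = 1 := by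
  choose A hA hAn using fun x => exists_equiv_of_le_norm hc (hlow x)
  have hs : ∀ x, HasStrictFDerivAt (fun y => y + φ y) (A x : E →L[ℝ] E) x := fun x => by
    rw [hA]
    exact (hasStrictFDerivAt_id x).add (hφ.contDiffAt.hasStrictFDerivAt one_ne_zero)
  have hev : ∀ᶠ x in cocompact E, ‖fderiv ℝ φ x‖ < 1 / 2 :=
    h0.eventually (gt_mem_nhds (by norm_num))
  obtain ⟨K, hK, hKs⟩ := mem_cocompact.1 hev
  obtain ⟨r, hr⟩ := hK.isBounded.exists_norm_le
  have hbij : Bijective (fun y => y + φ y) :=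
    bijective_id_add hR (hφ.differentiable one_ne_zero)
      (fun x hx => le_of_lt (hKs fun hxK => (hr x hxK).not_gt hx)) fun x => ⟨A x, hs x⟩
  refine ⟨hbij, fun x => ((A (invFun (fun y => y + φ y) x)).symm : E →L[ℝ] E), fun x =>
    ⟨?_, hAn _, ?_, ?_⟩⟩
  · have h1 := (hs (invFun (fun y => y + φ y) x)).to_local_left_inverse
      (Eventually.of_forall (leftInverse_invFun hbij.1))
    have h2 : _ + φ _ = x := rightInverse_invFun hbij.2 x
    rw [h2] at h1
    exact h1.hasFDerivAt
  · rw [← hA]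
    exact ContinuousLinearEquiv.coe_comp_coe_symm _
  · rw [← hA]
    exact ContinuousLinearEquiv.coe_symm_comp_coe _

variable {d n : ℕ} {α β : ℝ}

theorem fderiv_id_add {E : Type*} [NormedAddCommGroup E] [NormedSpace ℝ E] {φ : E → E}
    (hφ : Differentiable ℝ φ) (x : E) : fderiv ℝ (fun y => y + φ y) x = 1 + fderiv ℝ φ x := by
  rw [fderiv_fun_add differentiableAt_fun_id (hφ x), fderiv_fun_id]
  rfl

theorem memD_id_add_iff (hn : 1 ≤ n) {φ : Euc d → Euc d} :
    MemD d n β (fun x => x + φ x) ↔ MemC0 n β φ ∧ ∀ x, 0 < (1 + fderiv ℝ φ x).det := by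
  simp only [MemD, add_sub_cancel_left]
  refine and_congr_right fun h => forall_congr' fun x => ?_
  have hd : Differentiable ℝ φ := (h.1.contDiff_of_le hn).differentiable (by simp)
  rw [fderiv_id_add hd]

theorem norm_fderiv_sub_le_hnorm {E F : Type*} [NormedAddCommGroup E] [NormedSpace ℝ E]
    [NormedAddCommGroup F] [NormedSpace ℝ F] (hn : 1 ≤ n) {φ ψ : E → F} (hφ : MemCb n β φ)
    (hψ : MemCb n β ψ) (x : E) :
    ‖fderiv ℝ φ x - fderiv ℝ ψ x‖ ≤ hnorm n β (φ - ψ) := by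
  have hd : ∀ {f : E → F}, MemCb n β f → Differentiable ℝ f := fun h =>
    (h.contDiff_of_le hn).differentiable (by simp)
  rw [← fderiv_sub (hd hφ x) (hd hψ x), ← norm_iteratedFDeriv_one]
  exact norm_iteratedFDeriv_le_hnorm (hφ.sub hψ).2 hn x

theorem exists_holder_invc (hn : 1 ≤ n) (hα : 0 < α) (hαβ : α < β) (hβ1 : β ≤ 1)
    {φ₀ : Euc d → Euc d} (h₀ : MemD d n β (fun x => x + φ₀ x)) :
    ∃ δ > (0 : ℝ),
      (∀ φ : Euc d → Euc d, MemC0 n β φ → hnorm n β (φ - φ₀) < δ →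
        MemD d n β (fun x => x + φ x)) ∧
      ∃ M : ℝ, ∀ φ₁ φ₂ : Euc d → Euc d, MemC0 n β φ₁ → MemC0 n β φ₂ →
        hnorm n β (φ₁ - φ₀) < δ → hnorm n β (φ₂ - φ₀) < δ →
        hnorm n α (fun x => invc φ₁ x - invc φ₂ x) ≤ M * hnorm n α (φ₁ - φ₂) ^ (β - α) := by
  have hβ : 0 < β := hα.trans hαβ
  obtain ⟨hφ₀, hdet⟩ := (memD_id_add_iff hn).1 h₀
  have hC1 : ∀ {φ : Euc d → Euc d}, MemC0 n β φ → ContDiff ℝ 1 φ := fun h =>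
    h.1.contDiff_of_le hn
  have hz : ∀ {φ : Euc d → Euc d}, MemC0 n β φ →
      Tendsto (fun x => ‖fderiv ℝ φ x‖) (cocompact _) (𝓝 0) := fun h => by
    simpa only [norm_iteratedFDeriv_one] using h.2 1 hn
  obtain ⟨c, hc, hlow⟩ := exists_uniform_le_norm ((hC1 hφ₀).continuous_fderiv one_ne_zero)
    (hz hφ₀) hdet
  have hclose : ∀ {φ : Euc d → Euc d}, MemC0 n β φ → hnorm n β (φ - φ₀) < c / 2 → ∀ x,
      ‖(1 + fderiv ℝ φ x) - (1 + fderiv ℝ φ₀ x)‖ ≤ c / 2 := fun h h' x => by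
    rw [add_sub_add_left_eq_sub]
    exact (norm_fderiv_sub_le_hnorm hn h.1 hφ₀.1 x).trans h'.le
  refine ⟨c / 2, by positivity, fun φ hφ hδ => (memD_id_add_iff hn).2 ⟨hφ, fun x =>
    ContinuousLinearMap.det_pos_of_norm_sub_lt (hlow x) (hdet x)
      ((hclose hφ hδ x).trans_lt (by linarith))⟩, ?_⟩
  let ι := {φ : Euc d → Euc d // MemC0 n β φ ∧ hnorm n β (φ - φ₀) < c / 2}
  let ε : ι → ι → ℝ := fun i j => hnorm n α (i.1 - j.1)
  set R : ℝ := hnorm n β φ₀ + c / 2 with hRdef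
  have hR0 : 0 ≤ R := add_nonneg hnorm_nonneg (by positivity)
  have hmem : ∀ i : ι, MemCb n β i.1 := fun i => i.2.1.1
  have hR : ∀ i : ι, hnorm n β i.1 ≤ R := fun i => by
    linarith [(hmem i).hnorm_le_add hφ₀.1, i.2.2]
  have hmemα : ∀ i j : ι, MemCb n α (i.1 - j.1) ∧
      hnorm n α (i.1 - j.1) ≤ 2 * hnorm n β (i.1 - j.1) := fun i j =>
    ((hmem i).sub (hmem j)).of_exponent_le hα hαβ.le
  have hε : ∀ i j, 0 ≤ ε i j := fun i j => hnorm_nonneg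
  have hε0 : ∀ i, ε i i = 0 := fun i => by
    refine le_antisymm (hnorm_le le_rfl (fun l hl x => ?_) fun x y => ?_) hnorm_nonneg
    · rw [(hmem i).iteratedFDeriv_sub (hmem i) hl]
      simp
    · rw [(hmem i).iteratedFDeriv_sub (hmem i) le_rfl, (hmem i).iteratedFDeriv_sub (hmem i) le_rfl]
      simp
  have hεT : ∀ i j, ε i j ≤ 4 * R + 1 := fun i j => by
    linarith [(hmemα i j).2, (hmem i).hnorm_sub_le (hmem j), hR i, hR j]
  have hφε : ∀ i j : ι, ∀ l ≤ n, ∀ x, ‖iteratedFDeriv ℝ l (i.1 - j.1) x‖ ≤ ε i j :=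
    fun i j l hl x => norm_iteratedFDeriv_le_hnorm (hmemα i j).1.2 hl x
  have hφ : UnifHolderN ε β n (fun i : ι => i.1) :=
    unifHolderN_of_hnorm_le hε hε0 hβ hβ1 (by linarith) hεT hmem hR hR0 hφε
  have hdata := fun i : ι => exists_hasFDerivAt_invFun_id_add (φ := i.1) (R := R) (c := c - c / 2)
    (hC1 i.2.1) (fun x => by
      simpa using (norm_iteratedFDeriv_le_hnorm (hmem i).2 (Nat.zero_le n) x).trans (hR i))
    (hz i.2.1) (by linarith) (fun x => le_norm_of_norm_sub_le (hlow x) (hclose i.2.1 i.2.2 x))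
  choose hbij B hB hBn hAB hBA using hdata
  obtain ⟨m, rfl⟩ : ∃ m, n = m + 1 := ⟨n - 1, by omega⟩
  have hψ : UnifHolderN ε β (m + 1) (fun i : ι => invc i.1) :=
    UnifHolderN.inverse_id_add hε hβ.le (inv_nonneg.2 (by linarith)) hφ
      (fun i => rightInverse_invFun (hbij i).2) (fun i => leftInverse_invFun (hbij i).1)
      hB hBn hAB hBA (fun i j x => by simpa using hφε i j 0 (Nat.zero_le _) x)
  obtain ⟨hψc, hψh⟩ := (unifHolderN_iff hε0 hβ).1 hψ
  choose! C hC _ hCh using hψh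
  obtain ⟨D, hD⟩ : ∃ D, ∀ l ≤ m + 1, C l ≤ D := by
    obtain ⟨D, hD⟩ := ((Set.finite_Iic (m + 1)).image C).bddAbove
    exact ⟨D, fun l hl => hD (mem_image_of_mem C hl)⟩
  have hD0 : 0 ≤ D := (hC 0 (Nat.zero_le _)).trans (hD 0 (Nat.zero_le _))
  refine ⟨D * (2 + (4 * R + 1) ^ α), fun φ₁ φ₂ h₁ h₂ h₁' h₂' => ?_⟩
  let i : ι := ⟨φ₁, h₁, h₁'⟩
  let j : ι := ⟨φ₂, h₂, h₂'⟩
  have hhol : ∀ (k : ι) (x y : Euc d), ‖iteratedFDeriv ℝ (m + 1) (invc k.1) x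
      - iteratedFDeriv ℝ (m + 1) (invc k.1) y‖ ≤ D * ‖x - y‖ ^ β := fun k x y => by
    have h := hCh (m + 1) le_rfl k k x y
    rw [hε0, zero_add] at h
    exact h.trans (mul_le_mul_of_nonneg_right (hD _ le_rfl) (by positivity))
  refine hnorm_sub_le_of_interpolation hα hαβ hD0 (hε i j) (hεT i j) (hψc i) (hψc j)
    (fun l hl x => ?_) (hhol i) (hhol j)
  have h := hCh l hl i j x x
  rw [sub_self, norm_zero, add_zero] at h
  exact h.trans (mul_le_mul_of_nonneg_right (hD l hl) (Real.rpow_nonneg (hε i j) _))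

end Diffeomorphisms

/-- Hölder continuity of inversion with loss of regularity:
for `0 < α < β ≤ 1` and `φ₀ ∈ D^{n,β}(ℝ^d) − Id` there is `δ > 0` such that the
`δ`-ball around `φ₀` lies in `D^{n,β}(ℝ^d) − Id` and
`‖inv_c(φ₁) − inv_c(φ₂)‖_{n,α} ≤ M ‖φ₁ − φ₂‖_{n,α}^{β−α}` on this ball;
in particular `Φ ↦ Φ⁻¹` is continuous from `D^{n,β}(ℝ^d)` to `D^{n,α}(ℝ^d)`. -/
theorem stmt11 (d n : ℕ) (hn : 1 ≤ n) (α β : ℝ) (hα : 0 < α) (hαβ : α < β) (hβ1 : β ≤ 1) :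
    (∀ φ₀ : Euc d → Euc d, MemD d n β (fun x => x + φ₀ x) →
      ∃ δ > (0 : ℝ),
        (∀ φ : Euc d → Euc d, MemC0 n β φ → hnorm n β (φ - φ₀) < δ →
          MemD d n β (fun x => x + φ x)) ∧
        ∃ M : ℝ, ∀ φ₁ φ₂ : Euc d → Euc d, MemC0 n β φ₁ → MemC0 n β φ₂ →
          hnorm n β (φ₁ - φ₀) < δ → hnorm n β (φ₂ - φ₀) < δ →
          hnorm n α (fun x => invc φ₁ x - invc φ₂ x) ≤
            M * hnorm n α (φ₁ - φ₂) ^ (β - α)) ∧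
    (∀ Φ₀ : Euc d → Euc d, MemD d n β Φ₀ → ∀ ε > (0 : ℝ), ∃ δ > (0 : ℝ),
      ∀ Φ : Euc d → Euc d, MemD d n β Φ → hnorm n β (fun x => Φ x - Φ₀ x) < δ →
        hnorm n α (fun x => Function.invFun Φ x - Function.invFun Φ₀ x) < ε) := by
  have hβ : 0 < β - α := sub_pos.2 hαβ
  refine ⟨fun φ₀ h₀ => exists_holder_invc hn hα hαβ hβ1 h₀, fun Φ₀ h₀ ε hε => ?_⟩
  have hadd : ∀ Φ : Euc d → Euc d, (fun x => x + (Φ x - x)) = Φ := fun Φ => by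
    ext1 x
    exact add_sub_cancel x (Φ x)
  have h₀' : MemD d n β (fun x => x + (Φ₀ x - x)) := by rwa [hadd]
  obtain ⟨δ, hδ, -, M, hM⟩ := exists_holder_invc (φ₀ := fun x => Φ₀ x - x) hn hα hαβ hβ1 h₀'
  obtain ⟨η, hη, hηε⟩ : ∃ η > 0, ∀ t, 0 ≤ t → t < η → M * t ^ (β - α) < ε := by
    have hc : Continuous fun t : ℝ => M * t ^ (β - α) :=
      continuous_const.mul (Real.continuous_rpow_const hβ.le)
    have hev : ∀ᶠ t in 𝓝 (0 : ℝ), M * t ^ (β - α) < ε :=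
      (hc.tendsto 0).eventually (gt_mem_nhds (by simpa [Real.zero_rpow hβ.ne'] using hε))
    obtain ⟨η, hη, h⟩ := Metric.eventually_nhds_iff.1 hev
    exact ⟨η, hη, fun t ht htη => h (by simpa [abs_of_nonneg ht] using htη)⟩
  refine ⟨min δ (η / 2), lt_min hδ (by linarith), fun Φ hΦ hlt => ?_⟩
  have hsub : (fun x => Φ x - x) - (fun x => Φ₀ x - x) = fun x => Φ x - Φ₀ x := by
    ext1 x
    exact sub_sub_sub_cancel_right _ _ _
  have h1 := hM (fun x => Φ x - x) (fun x => Φ₀ x - x) hΦ.1 h₀.1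
    (by rw [hsub]; exact hlt.trans_le (min_le_left _ _)) (by
      refine (hnorm_le le_rfl (fun l hl x => ?_) fun x y => ?_).trans_lt hδ
      · rw [h₀.1.1.iteratedFDeriv_sub h₀.1.1 hl]
        simp
      · rw [h₀.1.1.iteratedFDeriv_sub h₀.1.1 le_rfl, h₀.1.1.iteratedFDeriv_sub h₀.1.1 le_rfl]
        simp)
  have h2 := ((hΦ.1.1.sub h₀.1.1).of_exponent_le hα hαβ.le).2
  simp only [invc, hadd, sub_sub_sub_cancel_right] at h1
  rw [hsub] at h1 h2
  refine h1.trans_lt (hηε _ hnorm_nonneg ?_)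
  linarith [hlt.trans_le (min_le_right _ _)]
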